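/- arXiv:math/0107008 — 2 statements merged into one kernel-verified Lean document; each statement's English description precedes it below -/
import Mathlib

section
/- Let X and Y be cocompact G-trees that are related by an elementary deformation. If X is strongly slide-free and Y is reduced, then there is a unique isomorphism of G-trees X → Y. -/
universe u

/-- A `G`-tree: a simplicial tree together with an action of `G` by graph
automorphisms without inversions. -/
structure GTree (G : Type u) [Group G] : Type (u + 1) where
  V : Type u
  graph : SimpleGraph V
  isTree : graph.IsTree
  smul : G → V → V
  smul_one : ∀ x, smul 1 x = x
  smul_mul : ∀ γ δ x, smul (γ * δ) x = smul γ (smul δ x)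
  smul_adj : ∀ (γ : G) ⦃x y : V⦄, graph.Adj x y → graph.Adj (smul γ x) (smul γ y)
  no_inversions : ∀ (γ : G) (x y : V), graph.Adj x y → ¬(smul γ x = y ∧ smul γ y = x)

namespace GTree

variable {G : Type u} [Group G]

/-- Oriented edges of a `G`-tree. -/
def Edge (X : GTree G) : Type u := { p : X.V × X.V // X.graph.Adj p.1 p.2 }

/-- Initial vertex `∂₀ e` of an oriented edge. -/
def d0 {X : GTree G} (e : X.Edge) : X.V := e.1.1

/-- Terminal vertex `∂₁ e` of an oriented edge. -/
def d1 {X : GTree G} (e : X.Edge) : X.V := e.1.2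

/-- The underlying geometric (unoriented) edge. -/
def esym {X : GTree G} (e : X.Edge) : Sym2 X.V := s(e.1.1, e.1.2)

/-- Action of `G` on oriented edges. -/
def edgeSmul {X : GTree G} (γ : G) (e : X.Edge) : X.Edge :=
  ⟨(X.smul γ e.1.1, X.smul γ e.1.2), X.smul_adj γ e.2⟩

/-- Vertex stabilizer `G_x`. -/
def stab (X : GTree G) (x : X.V) : Subgroup G where
  carrier := { γ | X.smul γ x = x }
  one_mem' := X.smul_one x
  mul_mem' := by
    intro a b ha hb
    simp only [Set.mem_setOf_eq] at *
    rw [X.smul_mul, hb, ha]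
  inv_mem' := by
    intro a ha
    simp only [Set.mem_setOf_eq] at *
    conv_lhs => rw [← ha]
    rw [← X.smul_mul, inv_mul_cancel, X.smul_one]

/-- Edge stabilizer `G_e`: the elements fixing both endpoints (since the action
is without inversions, these are exactly the elements fixing the edge). -/
def edgeStab (X : GTree G) (e : X.Edge) : Subgroup G :=
  X.stab (d0 e) ⊓ X.stab (d1 e)

/-- An element of `G` is elliptic if it fixes a vertex. -/
def Elliptic (X : GTree G) (γ : G) : Prop := ∃ x, X.smul γ x = x

/-- A subgroup of `G` is elliptic if it fixes a vertex. -/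
def FixesVertex (X : GTree G) (H : Subgroup G) : Prop := ∃ x, ∀ γ ∈ H, X.smul γ x = x

/-- Two `G`-trees have the same elliptic subgroups. -/
def SameEllipticSubgroups (X Y : GTree G) : Prop :=
  ∀ H : Subgroup G, X.FixesVertex H ↔ Y.FixesVertex H

/-- The length function `ℓ_X(γ)`: the minimal vertex displacement. -/
noncomputable def transLen (X : GTree G) (γ : G) : ℕ :=
  sInf (Set.range fun x => X.graph.dist x (X.smul γ x))

/-- Cocompact: the quotient graph `G\X` is finite, i.e. there are finitely
many orbits of vertices and of edges. -/
def Cocompact (X : GTree G) : Prop :=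
  Finite (Quot fun x y : X.V => ∃ γ, X.smul γ x = y) ∧
    Finite (Quot fun e f : X.Edge => ∃ γ, edgeSmul γ e = f)

/-- Reduced: whenever `G_e = G_{∂₀ e}`, the endpoints of `e` are in the same
`G`-orbit. -/
def Reduced (X : GTree G) : Prop :=
  ∀ e : X.Edge, X.edgeStab e = X.stab (d0 e) → ∃ γ, X.smul γ (d0 e) = d1 e

/-- A nonempty `G`-invariant subtree (a nonempty invariant set of vertices that
is connected in the induced graph). -/
def IsInvariantSubtree (X : GTree G) (S : Set X.V) : Prop :=
  S.Nonempty ∧ (∀ γ, ∀ x ∈ S, X.smul γ x ∈ S) ∧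
    ∀ x ∈ S, ∀ y ∈ S, ∃ p : X.graph.Walk x y, ∀ v ∈ p.support, v ∈ S

/-- Minimal: there is no proper nonempty invariant subtree. -/
def Minimal (X : GTree G) : Prop :=
  ∀ S : Set X.V, X.IsInvariantSubtree S → S = Set.univ

/-- Strongly slide-free: minimal, and for all edges `e`, `f` with
`∂₀ e = ∂₀ f`, the inclusion `G_e ⊆ G_f` implies `f ∈ G e`. -/
def StronglySlideFree (X : GTree G) : Prop :=
  X.Minimal ∧ ∀ e f : X.Edge, d0 e = d0 f → X.edgeStab e ≤ X.edgeStab f →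
    ∃ γ, edgeSmul γ e = f

/-- Proper: `G_e ⊊ G_{∂₀ e}` for every edge `e`. -/
def Proper (X : GTree G) : Prop := ∀ e : X.Edge, X.edgeStab e < X.stab (d0 e)

/-- Locally finite: every vertex has finite valence. -/
def LocallyFinite (X : GTree G) : Prop := ∀ x : X.V, (X.graph.neighborSet x).Finite

/-- `φ` is an isomorphism of `G`-trees: an equivariant graph isomorphism. -/
def IsGIso (X Y : GTree G) (φ : X.V → Y.V) : Prop :=
  Function.Bijective φ ∧ (∀ x y, X.graph.Adj x y ↔ Y.graph.Adj (φ x) (φ y)) ∧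
    ∀ γ x, φ (X.smul γ x) = Y.smul γ (φ x)

/-- `φ : X → Y` is the collapse move performed at (the orbit of) the edge `e`:
`G_e = G_{∂₀ e}`, the endpoints of `e` lie in different `G`-orbits, and `Y` is
the equivariant quotient of `X` identifying `∂₀(γ e)` with `∂₁(γ e)` for all
`γ ∈ G`. -/
def IsCollapse (X Y : GTree G) (φ : X.V → Y.V) (e : X.Edge) : Prop :=
  X.edgeStab e = X.stab (d0 e) ∧
  (∀ γ : G, X.smul γ (d0 e) ≠ d1 e) ∧
  Function.Surjective φ ∧
  (∀ γ x, φ (X.smul γ x) = Y.smul γ (φ x)) ∧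
  (∀ u v : X.V, φ u = φ v ↔
    Relation.EqvGen (fun a b => ∃ γ : G, a = X.smul γ (d0 e) ∧ b = X.smul γ (d1 e)) u v) ∧
  (∀ a b : Y.V, a ≠ b → (Y.graph.Adj a b ↔ ∃ u v, X.graph.Adj u v ∧ φ u = a ∧ φ v = b))

/-- `Y` is obtained from `X` by a collapse move. -/
def Collapse (X Y : GTree G) : Prop := ∃ (φ : X.V → Y.V) (e : X.Edge), IsCollapse X Y φ e

/-- Elementary deformation: a finite composition of collapse moves and their
inverses (expansion moves). -/
def ElemDeformation : GTree G → GTree G → Prop := Relation.EqvGen Collapse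

end GTree

namespace GTree

variable {G : Type u} [Group G]

section Action

variable (X : GTree G)

theorem smul_inv_smul (γ : G) (x : X.V) : X.smul γ (X.smul γ⁻¹ x) = x := by
  rw [← X.smul_mul, mul_inv_cancel, X.smul_one]

theorem inv_smul_smul (γ : G) (x : X.V) : X.smul γ⁻¹ (X.smul γ x) = x := by
  rw [← X.smul_mul, inv_mul_cancel, X.smul_one]

theorem smul_injective (γ : G) : Function.Injective (X.smul γ) :=
  Function.LeftInverse.injective (X.inv_smul_smul γ)

theorem inv_smul_eq_iff {γ : G} {x y : X.V} : X.smul γ⁻¹ x = y ↔ x = X.smul γ y :=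
  ⟨fun h => by rw [← h, smul_inv_smul], fun h => by rw [h, inv_smul_smul]⟩

theorem mem_stab {x : X.V} {γ : G} : γ ∈ X.stab x ↔ X.smul γ x = x := Iff.rfl

/-- Two translates of `o` agree only if the corresponding translates of `t` do, provided the
stabilizer of `o` fixes `t`. -/
theorem smul_eq_smul_of_stab_le {Y : GTree G} {o : X.V} {t : Y.V} (h : X.stab o ≤ Y.stab t)
    {γ δ : G} (hγ : X.smul γ o = X.smul δ o) : Y.smul γ t = Y.smul δ t := by
  have : δ⁻¹ * γ ∈ Y.stab t := h <| by
    rw [mem_stab, X.smul_mul, hγ, inv_smul_smul]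
  rw [mem_stab, Y.smul_mul, inv_smul_eq_iff] at this
  exact this

end Action

section Geodesics

variable (X : GTree G)

/-- The action of a group element as a graph homomorphism. -/
def smulHom (γ : G) : X.graph →g X.graph where
  toFun := X.smul γ
  map_rel' h := X.smul_adj γ h

/-- The unique path joining two vertices. -/
noncomputable def geodesic (x y : X.V) : X.graph.Walk x y :=
  (X.isTree.existsUnique_path x y).choose

theorem geodesic_isPath (x y : X.V) : (X.geodesic x y).IsPath :=
  (X.isTree.existsUnique_path x y).choose_spec.1

theorem eq_geodesic {x y : X.V} {p : X.graph.Walk x y} (hp : p.IsPath) : p = X.geodesic x y :=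
  (X.isTree.existsUnique_path x y).choose_spec.2 p hp

theorem geodesic_smul (γ : G) (x y : X.V) :
    X.geodesic (X.smul γ x) (X.smul γ y) = (X.geodesic x y).map (X.smulHom γ) := by
  have h : ((X.geodesic x y).map (X.smulHom γ)).IsPath :=
    (X.geodesic_isPath x y).map (X.smul_injective γ)
  exact (X.eq_geodesic h).symm

/-- The first vertex after `x` on the path from `x` to `y`. -/
noncomputable def next (x y : X.V) : X.V := (X.geodesic x y).snd

theorem not_nil_geodesic {x y : X.V} (h : x ≠ y) : ¬(X.geodesic x y).Nil :=
  SimpleGraph.Walk.not_nil_of_ne h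

theorem adj_next {x y : X.V} (h : x ≠ y) : X.graph.Adj x (X.next x y) :=
  (X.geodesic x y).adj_snd (X.not_nil_geodesic h)

theorem next_smul (γ : G) (x y : X.V) :
    X.next (X.smul γ x) (X.smul γ y) = X.smul γ (X.next x y) := by
  unfold next
  rw [geodesic_smul]
  exact SimpleGraph.Walk.getVert_map _ _ _

theorem length_geodesic_smul (γ : G) (x y : X.V) :
    (X.geodesic (X.smul γ x) (X.smul γ y)).length = (X.geodesic x y).length := by
  rw [geodesic_smul]
  exact SimpleGraph.Walk.length_map _ _

theorem length_geodesic_self (x : X.V) : (X.geodesic x x).length = 0 := by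
  rw [← X.eq_geodesic (SimpleGraph.Walk.IsPath.nil (u := x))]
  rfl

theorem next_self (x : X.V) : X.next x x = x := by
  unfold next
  rw [← X.eq_geodesic (SimpleGraph.Walk.IsPath.nil (u := x))]
  rfl

theorem length_geodesic_next {x y : X.V} (h : x ≠ y) :
    (X.geodesic (X.next x y) y).length + 1 = (X.geodesic x y).length := by
  rw [← SimpleGraph.Walk.length_tail_add_one (X.not_nil_geodesic h)]
  congr 2
  exact (X.eq_geodesic (X.geodesic_isPath x y).tail).symm

theorem next_eq_or_next_eq {u v : X.V} (y : X.V) (h : X.graph.Adj u v) :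
    X.next u y = v ∨ X.next v y = u := by
  by_cases hv : v ∈ (X.geodesic u y).support
  · exact .inl (X.isTree.isAcyclic.eq_snd_of_adj_start (X.geodesic_isPath u y) h hv).symm
  · right
    unfold next
    rw [← X.eq_geodesic ((X.geodesic_isPath u y).cons (h := h.symm) hv)]
    simp

theorem stab_inf_stab_le_next (x y : X.V) : X.stab x ⊓ X.stab y ≤ X.stab (X.next x y) := by
  rintro γ ⟨hx, hy⟩
  have := X.next_smul γ x y
  rw [X.mem_stab.1 hx, X.mem_stab.1 hy] at this
  exact this.symm

end Geodesics

section Push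

open Classical in
/-- The equivariant map sending the translates of `o` to the corresponding translates of `t` and
fixing every other vertex. -/
noncomputable def push (X : GTree G) (o t : X.V) (w : X.V) : X.V :=
  if h : ∃ γ, w = X.smul γ o then X.smul h.choose t else w

variable {X : GTree G} {o t : X.V}

theorem push_smul_self (h : X.stab o ≤ X.stab t) (γ : G) :
    X.push o t (X.smul γ o) = X.smul γ t := by
  have hex : ∃ δ, X.smul γ o = X.smul δ o := ⟨γ, rfl⟩
  rw [push, dif_pos hex]
  exact (smul_eq_smul_of_stab_le X h hex.choose_spec).symm

theorem push_of_forall_ne {w : X.V} (hw : ∀ γ, w ≠ X.smul γ o) : X.push o t w = w :=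
  dif_neg (not_exists.2 hw)

theorem push_smul (h : X.stab o ≤ X.stab t) (γ : G) (w : X.V) :
    X.push o t (X.smul γ w) = X.smul γ (X.push o t w) := by
  by_cases hw : ∃ δ, w = X.smul δ o
  · obtain ⟨δ, rfl⟩ := hw
    rw [← X.smul_mul, push_smul_self h, push_smul_self h, X.smul_mul]
  · push Not at hw
    rw [push_of_forall_ne hw, push_of_forall_ne]
    intro δ hδ
    refine hw (γ⁻¹ * δ) ?_
    rw [X.smul_mul, ← hδ, inv_smul_smul]

end Push

section Proper

variable {X : GTree G}

/-- A strongly slide-free tree is proper. -/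
theorem StronglySlideFree.proper (hX : X.StronglySlideFree) : X.Proper := by
  rintro ⟨⟨o, t⟩, hot⟩
  refine lt_of_le_of_ne inf_le_left fun heq => ?_
  replace hot : X.graph.Adj o t := hot
  have hle : X.stab o ≤ X.stab t := inf_eq_left.1 heq
  have hleaf : ∀ v, X.graph.Adj o v → v = t := by
    intro v hv
    obtain ⟨γ, hγ⟩ := hX.2 ⟨(o, v), hv⟩ ⟨(o, t), hot⟩ rfl
      (le_trans inf_le_left heq.ge)
    have h1 : X.smul γ o = o := congrArg (fun e => e.1.1) hγ
    have h2 : X.smul γ v = t := congrArg (fun e => e.1.2) hγ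
    exact X.smul_injective γ (h2.trans (hle h1).symm)
  have hleaf' : ∀ γ v, X.graph.Adj (X.smul γ o) v → v = X.smul γ t := by
    intro γ v hv
    have := X.smul_adj γ⁻¹ hv
    rw [X.inv_smul_smul] at this
    rw [← hleaf _ this, smul_inv_smul]
  have ht : ∀ γ, t ≠ X.smul γ o := by
    rintro γ rfl
    exact X.no_inversions γ o _ hot ⟨rfl, (hleaf' γ o hot.symm).symm⟩
  have hS : ∀ w, ∀ γ, X.push o t w ≠ X.smul γ o := by
    intro w γ
    by_cases hw : ∃ δ, w = X.smul δ o
    · obtain ⟨δ, rfl⟩ := hw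
      rw [push_smul_self hle]
      intro h
      refine ht (δ⁻¹ * γ) ?_
      rw [X.smul_mul, ← h, inv_smul_smul]
    · push Not at hw
      rw [push_of_forall_ne hw]
      exact hw γ
  have hinv : X.IsInvariantSubtree {v | ∀ γ, v ≠ X.smul γ o} := by
    refine ⟨⟨t, ht⟩, ?_, ?_⟩
    · intro γ x hx δ h
      refine hx (γ⁻¹ * δ) ?_
      rw [X.smul_mul, ← h, inv_smul_smul]
    · have key : ∀ {u v : X.V} (_ : X.graph.Walk u v),
          ∃ q : X.graph.Walk (X.push o t u) (X.push o t v),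
            ∀ w ∈ q.support, ∀ γ, w ≠ X.smul γ o := by
        intro u v p
        induction p with
        | nil => exact ⟨.nil, by simpa using hS _⟩
        | @cons u w v h p ih =>
          obtain ⟨q, hq⟩ := ih
          by_cases hu : ∃ δ, u = X.smul δ o
          · obtain ⟨δ, rfl⟩ := hu
            obtain rfl := hleaf' δ w h
            have : X.push o t (X.smul δ o) = X.push o t (X.smul δ t) := by
              rw [push_smul_self hle, push_smul hle, push_of_forall_ne ht]
            rw [this]
            exact ⟨q, hq⟩
          by_cases hw : ∃ δ, w = X.smul δ o
          · obtain ⟨δ, rfl⟩ := hw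
            obtain rfl := hleaf' δ u h.symm
            have : X.push o t (X.smul δ o) = X.push o t (X.smul δ t) := by
              rw [push_smul_self hle, push_smul hle, push_of_forall_ne ht]
            rw [← this]
            exact ⟨q, hq⟩
          have hadj : X.graph.Adj (X.push o t u) (X.push o t w) := by
            rw [push_of_forall_ne (not_exists.1 hu), push_of_forall_ne (not_exists.1 hw)]
            exact h
          refine ⟨.cons hadj q, fun z hz => ?_⟩
          rw [SimpleGraph.Walk.support_cons, List.mem_cons] at hz
          rcases hz with rfl | hz
          · exact hS u
          · exact hq z hz
      intro x hx y hy
      obtain ⟨p⟩ := X.isTree.connected x y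
      have := key p
      rwa [push_of_forall_ne hx, push_of_forall_ne hy] at this
  have : o ∈ {v | ∀ γ, v ≠ X.smul γ o} := by
    rw [hX.1 _ hinv]
    trivial
  exact this 1 (X.smul_one o).symm

/-- In a proper tree, distinct vertices have incomparable stabilizers. -/
theorem Proper.eq_of_stab_le (hX : X.Proper) {x y : X.V} (h : X.stab x ≤ X.stab y) : x = y := by
  by_contra hne
  refine (hX ⟨(x, X.next x y), X.adj_next hne⟩).not_ge ?_
  exact le_inf le_rfl ((le_inf le_rfl h).trans (X.stab_inf_stab_le_next x y))

theorem Proper.unique_isGIso (hX : X.Proper) {Y : GTree G} {φ ψ : X.V → Y.V}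
    (hφ : IsGIso X Y φ) (hψ : IsGIso X Y ψ) : φ = ψ := by
  funext x
  obtain ⟨y, hy⟩ := hφ.1.2 (ψ x)
  rw [← hy, hX.eq_of_stab_le (x := x) (y := y)]
  intro γ hγ
  apply hφ.1.1
  rw [hφ.2.2, hy, ← hψ.2.2, X.mem_stab.1 hγ]

end Proper

section Resolution

/-- Adjacency within a fiber of `p`. -/
def FiberAdj {Z : GTree G} {α : Type*} (p : Z.V → α) (u v : Z.V) : Prop :=
  Z.graph.Adj u v ∧ p u = p v

/-- `p : Z → X` is an equivariant map with connected fibers, sending edges to edges or vertices,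
and `c` is an equivariant section of `p` on vertices. -/
structure IsResolution {Z X : GTree G} (p : Z.V → X.V) (c : X.V → Z.V) : Prop where
  map_smul : ∀ γ w, p (Z.smul γ w) = X.smul γ (p w)
  section_smul : ∀ γ x, c (X.smul γ x) = Z.smul γ (c x)
  map_section : ∀ x, p (c x) = x
  map_adj : ∀ {u v}, Z.graph.Adj u v → p u = p v ∨ X.graph.Adj (p u) (p v)
  chain : ∀ w, Relation.ReflTransGen (FiberAdj p) w (c (p w))

/-- `Z` admits an equivariant collapse onto `X` along a forest whose components have fixed
vertices. -/
def Resolves (Z X : GTree G) : Prop :=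
  ∃ (p : Z.V → X.V) (c : X.V → Z.V), IsResolution p c

theorem Resolves.refl (X : GTree G) : Resolves X X :=
  ⟨id, id, fun _ _ => rfl, fun _ _ => rfl, fun _ => rfl, .inr, fun _ => .refl⟩

theorem FiberAdj.symm {Z : GTree G} {α : Type*} {p : Z.V → α} {u v : Z.V} (h : FiberAdj p u v) :
    FiberAdj p v u :=
  ⟨h.1.symm, h.2.symm⟩

theorem chain_symm {Z : GTree G} {α : Type*} {p : Z.V → α} {u v : Z.V}
    (h : Relation.ReflTransGen (FiberAdj p) u v) : Relation.ReflTransGen (FiberAdj p) v u :=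
  haveI : Std.Symm (FiberAdj p) := ⟨fun _ _ => FiberAdj.symm⟩
  Std.Symm.symm _ _ h

theorem exists_walk_of_chain {Z : GTree G} {α : Type*} {p : Z.V → α} {u v : Z.V}
    (h : Relation.ReflTransGen (FiberAdj p) u v) :
    ∃ q : Z.graph.Walk u v, ∀ w ∈ q.support, p w = p u := by
  induction h using Relation.ReflTransGen.head_induction_on with
  | refl => exact ⟨.nil, by simp⟩
  | head h _ ih =>
    obtain ⟨q, hq⟩ := ih
    refine ⟨.cons h.1 q, fun w hw => ?_⟩
    rw [SimpleGraph.Walk.support_cons, List.mem_cons] at hw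
    rcases hw with rfl | hw
    · rfl
    · rw [hq w hw, h.2]

theorem map_next_of_chain {Z : GTree G} {α : Type*} {p : Z.V → α} {u v : Z.V}
    (h : Relation.ReflTransGen (FiberAdj p) u v) : p (Z.next u v) = p u := by
  classical
  obtain ⟨q, hq⟩ := exists_walk_of_chain h
  refine hq _ (q.support_bypass_subset_support ?_)
  rw [Z.eq_geodesic q.bypass_isPath]
  exact (Z.geodesic u v).getVert_mem_support 1

theorem reachable_deleteEdges_of_chain {Z : GTree G} {α : Type*} {p : Z.V → α} {u v a b : Z.V}
    (h : Relation.ReflTransGen (FiberAdj p) u v) (hab : p a ≠ p b) :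
    (Z.graph.deleteEdges {s(a, b)}).Reachable u v := by
  induction h with
  | refl => rfl
  | @tail x y _ hxy ih =>
    refine ih.trans (SimpleGraph.Adj.reachable ?_)
    rw [SimpleGraph.deleteEdges_adj]
    refine ⟨hxy.1, fun hmem => hab ?_⟩
    rcases Sym2.eq_iff.1 (Set.mem_singleton_iff.1 hmem) with ⟨rfl, rfl⟩ | ⟨rfl, rfl⟩
    · exact hxy.2
    · exact hxy.2.symm

namespace IsResolution

variable {Z X : GTree G} {p : Z.V → X.V} {c : X.V → Z.V} (hp : IsResolution p c)
include hp

theorem chain_of_map_eq {u v : Z.V} (h : p u = p v) : Relation.ReflTransGen (FiberAdj p) u v :=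
  (hp.chain u).trans (h ▸ chain_symm (hp.chain v))

/-- An edge of `X` has at most one lift. -/
theorem lift_unique {u v u' v' : Z.V} (h : Z.graph.Adj u v) (h' : Z.graph.Adj u' v')
    (hne : p u ≠ p v) (hu : p u = p u') (hv : p v = p v') : u = u' ∧ v = v' := by
  by_contra hcon
  have hbr := SimpleGraph.isAcyclic_iff_forall_adj_isBridge.1 Z.isTree.isAcyclic h
  rw [SimpleGraph.isBridge_iff] at hbr
  refine hbr ?_
  refine (reachable_deleteEdges_of_chain (hp.chain_of_map_eq hu) hne).trans
    (.trans (SimpleGraph.Adj.reachable ?_)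
      (reachable_deleteEdges_of_chain (hp.chain_of_map_eq hv.symm) hne))
  rw [SimpleGraph.deleteEdges_adj]
  refine ⟨h', fun hmem => ?_⟩
  rcases Sym2.eq_iff.1 (Set.mem_singleton_iff.1 hmem) with ⟨rfl, rfl⟩ | ⟨rfl, rfl⟩
  · exact hcon ⟨rfl, rfl⟩
  · exact hne hu

theorem stab_le_map (w : Z.V) : Z.stab w ≤ X.stab (p w) := fun γ hγ => by
  rw [mem_stab, ← hp.map_smul, Z.mem_stab.1 hγ]

theorem stab_le_section (x : X.V) : X.stab x ≤ Z.stab (c x) := fun γ hγ => by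
  rw [mem_stab, ← hp.section_smul, X.mem_stab.1 hγ]

theorem map_next (w : Z.V) : p (Z.next w (c (p w))) = p w :=
  map_next_of_chain (hp.chain w)

/-- A resolution by a reduced tree is an isomorphism. -/
theorem injective_of_reduced (hZ : Z.Reduced) : Function.Injective p := by
  suffices h : ∀ w, w = c (p w) by
    intro u v huv
    rw [h u, h v, huv]
  intro w
  by_contra hw
  obtain ⟨n, hn⟩ : ∃ n, (Z.geodesic w (c (p w))).length = n := ⟨_, rfl⟩
  induction n generalizing w with
  | zero =>
    exact hw (SimpleGraph.Walk.eq_of_length_eq_zero hn)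
  | succ n ih =>
    set v := Z.next w (c (p w)) with hv
    have hpv : p v = p w := hp.map_next w
    by_cases hvc : v = c (p w)
    · have hle : Z.stab w ≤ Z.stab v := by
        rw [hvc]
        exact (hp.stab_le_map w).trans (hp.stab_le_section _)
      obtain ⟨γ, hγ⟩ := hZ ⟨(w, v), Z.adj_next hw⟩ (inf_eq_left.2 hle)
      replace hγ : Z.smul γ w = v := hγ
      have hfix : X.smul γ (p w) = p w := by rw [← hp.map_smul, hγ, hpv]
      refine hw (Z.smul_injective γ ?_)
      rw [hγ, ← hp.section_smul, hfix, hvc]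
    · refine ih v (by rwa [hpv]) ?_
      rw [hpv]
      have := Z.length_geodesic_next hw
      rw [← hv] at this
      omega

theorem isGIso_section (hZ : Z.Reduced) : IsGIso X Z c := by
  have hinj := hp.injective_of_reduced hZ
  have hcp : ∀ w, c (p w) = w := fun w => hinj (hp.map_section _)
  have hcinj : Function.Injective c := Function.LeftInverse.injective hp.map_section
  refine ⟨⟨hcinj, fun w => ⟨p w, hcp w⟩⟩, ?_, hp.section_smul⟩
  have hback : ∀ {u v}, Z.graph.Adj u v → X.graph.Adj (p u) (p v) := fun h =>
    (hp.map_adj h).resolve_left fun heq => h.ne (hinj heq)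
  intro x y
  refine ⟨fun h => ?_, fun h => by simpa only [hp.map_section] using hback h⟩
  -- the image of the geodesic of `Z` is the geodesic of `X`
  let f : Z.graph →g X.graph := ⟨p, hback⟩
  have hpath : ((Z.geodesic (c x) (c y)).map f).IsPath := (Z.geodesic_isPath _ _).map hinj
  have hlen := SimpleGraph.Walk.length_map f (Z.geodesic (c x) (c y))
  have hone : (X.geodesic x y).length = 1 := by
    have hpa : (SimpleGraph.Walk.cons h .nil).IsPath := by
      simpa using h.ne
    rw [← X.eq_geodesic hpa]
    rfl
  rw [X.eq_geodesic hpath] at hlen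
  have hx : f (c x) = x := hp.map_section x
  have hy : f (c y) = y := hp.map_section y
  rw [hx, hy, hone] at hlen
  exact SimpleGraph.Walk.adj_of_length_eq_one hlen.symm

end IsResolution

end Resolution

section Moves

variable {Z Z' X : GTree G} {φ : Z.V → Z'.V} {e : Z.Edge}

namespace IsCollapse

variable (h : IsCollapse Z Z' φ e)
include h

theorem surjective : Function.Surjective φ := h.2.2.1

theorem map_smul (γ : G) (w : Z.V) : φ (Z.smul γ w) = Z'.smul γ (φ w) := h.2.2.2.1 γ w

theorem map_eq_iff {u v : Z.V} : φ u = φ v ↔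
    Relation.EqvGen (fun a b => ∃ γ : G, a = Z.smul γ (d0 e) ∧ b = Z.smul γ (d1 e)) u v :=
  h.2.2.2.2.1 u v

theorem adj_iff {a b : Z'.V} (hab : a ≠ b) :
    Z'.graph.Adj a b ↔ ∃ u v, Z.graph.Adj u v ∧ φ u = a ∧ φ v = b :=
  h.2.2.2.2.2 a b hab

theorem stab_le : Z.stab (d0 e) ≤ Z.stab (d1 e) := inf_eq_left.1 h.1

theorem map_d0 : φ (d0 e) = φ (d1 e) :=
  (h.map_eq_iff).2 (.rel _ _ ⟨1, (Z.smul_one _).symm, (Z.smul_one _).symm⟩)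

theorem d1_ne (γ : G) : d1 e ≠ Z.smul γ (d0 e) := fun heq => h.2.1 γ heq.symm

/-- An equivariant map identifying the endpoints of `e` is constant on the fibers of the
collapse. -/
theorem eq_of_map_eq {Y : GTree G} {q : Z.V → Y.V} (hq : ∀ γ w, q (Z.smul γ w) = Y.smul γ (q w))
    (he : q (d0 e) = q (d1 e)) {u v : Z.V} (huv : φ u = φ v) : q u = q v := by
  have := (h.map_eq_iff).1 huv
  induction this with
  | rel a b hab =>
    obtain ⟨γ, rfl, rfl⟩ := hab
    rw [hq, hq, he]
  | refl => rfl
  | symm a b hab ih => exact (ih ((h.map_eq_iff).2 hab)).symm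
  | trans a b c hab hbc ih₁ ih₂ =>
    exact (ih₁ ((h.map_eq_iff).2 hab)).trans (ih₂ ((h.map_eq_iff).2 hbc))

theorem chain {α : Type*} (q : Z'.V → α) {u v : Z.V} (huv : φ u = φ v) :
    Relation.ReflTransGen (FiberAdj (q ∘ φ)) u v := by
  have := (h.map_eq_iff).1 huv
  clear huv
  induction this with
  | rel a b hab =>
    obtain ⟨γ, rfl, rfl⟩ := hab
    refine .single ⟨Z.smul_adj γ e.2, ?_⟩
    rw [Function.comp_apply, Function.comp_apply, h.map_smul, h.map_smul, h.map_d0]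
  | refl => exact .refl
  | symm a b _ ih => exact chain_symm ih
  | trans a b c _ _ ih₁ ih₂ => exact ih₁.trans ih₂

/-- A resolution by the collapsed tree pulls back. -/
theorem isResolution_comp {p : Z'.V → X.V} {c : X.V → Z'.V} (hp : IsResolution p c)
    {σ : Z'.V → Z.V} (hσ : Function.RightInverse σ φ) :
    IsResolution (p ∘ φ)
      (fun x => Z.push (d0 e) (d1 e) (σ (c x))) := by
  have hpush : ∀ {u v}, φ u = φ v → Z.push (d0 e) (d1 e) u = Z.push (d0 e) (d1 e) v := by
    refine h.eq_of_map_eq (push_smul h.stab_le) ?_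
    have := push_smul_self h.stab_le 1
    rw [Z.smul_one, Z.smul_one] at this
    rw [this, push_of_forall_ne h.d1_ne]
  have hφ : ∀ w, φ (Z.push (d0 e) (d1 e) w) = φ w := by
    intro w
    by_cases hw : ∃ γ, w = Z.smul γ (d0 e)
    · obtain ⟨γ, rfl⟩ := hw
      rw [push_smul_self h.stab_le, h.map_smul, h.map_smul, h.map_d0]
    · rw [push_of_forall_ne (not_exists.1 hw)]
  have hchain : ∀ {a b}, Relation.ReflTransGen (FiberAdj p) a b → ∀ {u v}, φ u = a → φ v = b →
      Relation.ReflTransGen (FiberAdj (p ∘ φ)) u v := by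
    intro a b hab
    induction hab with
    | refl => exact fun hu hv => h.chain p (hu.trans hv.symm)
    | @tail b d _ hbd ih =>
      intro u v hu hv
      obtain ⟨s, t, hst, hs, ht⟩ := (h.adj_iff hbd.1.ne).1 hbd.1
      refine ((ih hu hs).tail ⟨hst, ?_⟩).trans (h.chain p (ht.trans hv.symm))
      simp only [Function.comp_apply, hs, ht, hbd.2]
  refine ⟨?_, ?_, ?_, ?_, ?_⟩
  · intro γ w
    rw [Function.comp_apply, h.map_smul, hp.map_smul]
    rfl
  · intro γ x
    rw [← push_smul h.stab_le]
    apply hpush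
    rw [hσ, h.map_smul, hσ, hp.section_smul]
  · intro x
    rw [Function.comp_apply, hφ, hσ, hp.map_section]
  · intro u v huv
    by_cases heq : φ u = φ v
    · exact .inl (congrArg p heq)
    · exact hp.map_adj ((h.adj_iff heq).2 ⟨u, v, huv, rfl, rfl⟩)
  · intro w
    refine hchain (hp.chain (φ w)) rfl ?_
    rw [hφ, hσ]
    rfl

/-- A resolution identifying the endpoints of the collapsed edge descends. -/
theorem isResolution_desc {p : Z.V → X.V} {c : X.V → Z.V} (hp : IsResolution p c)
    {σ : Z'.V → Z.V} (hσ : Function.RightInverse σ φ) (he : p (d0 e) = p (d1 e)) :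
    IsResolution (fun a => p (σ a)) (φ ∘ c) := by
  have hdesc : ∀ w, p (σ (φ w)) = p w := fun w =>
    h.eq_of_map_eq hp.map_smul he (hσ _)
  refine ⟨?_, ?_, ?_, ?_, ?_⟩
  · intro γ a
    obtain ⟨w, rfl⟩ := h.surjective a
    rw [← h.map_smul, hdesc, hdesc, hp.map_smul]
  · intro γ x
    rw [Function.comp_apply, hp.section_smul, h.map_smul]
    rfl
  · intro x
    rw [Function.comp_apply, hdesc, hp.map_section]
  · intro a b hab
    obtain ⟨u, v, huv, rfl, rfl⟩ := (h.adj_iff hab.ne).1 hab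
    rw [hdesc, hdesc]
    exact hp.map_adj huv
  · intro a
    obtain ⟨w, rfl⟩ := h.surjective a
    rw [hdesc]
    have := hp.chain w
    rw [Function.comp_apply]
    generalize c (p w) = z at this ⊢
    induction this with
    | refl => exact .refl
    | @tail s t _ hst ih =>
      by_cases heq : φ s = φ t
      · rwa [← heq]
      · refine ih.tail ⟨(h.adj_iff heq).2 ⟨s, t, hst.1, rfl, rfl⟩, ?_⟩
        exact (hdesc s).trans (hst.2.trans (hdesc t).symm)

end IsCollapse

end Moves

section Slide

variable {Z X : GTree G} (p : Z.V → X.V) (c : X.V → Z.V) (o t : Z.V)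

/-- The neighbor of `w` towards the root `c (p w)` of its fiber, or `w` itself if it is the
root. -/
noncomputable def parent (w : Z.V) : Z.V := Z.next w (c (p w))

/-- The distance from `w` to the root of its fiber. -/
noncomputable def height (w : Z.V) : ℕ := (Z.geodesic w (c (p w))).length

/-- `w` is a descendant, in its fiber, of some translate of `o`. -/
def IsBelow (w : Z.V) : Prop := ∃ (γ : G) (n : ℕ), (parent p c)^[n] w = Z.smul γ o

open Classical in
/-- The equivariant map sending all descendants of `γ o` to `γ t`. -/
noncomputable def slide (w : Z.V) : Z.V :=
  if h : IsBelow p c o w then Z.smul h.choose t else w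

variable {p c o t}

theorem slide_of_not_isBelow {w : Z.V} (hw : ¬IsBelow p c o w) : slide p c o t w = w :=
  dif_neg hw

theorem isBelow_of_iterate {w : Z.V} {n : ℕ} (h : IsBelow p c o ((parent p c)^[n] w)) :
    IsBelow p c o w := by
  obtain ⟨γ, m, hm⟩ := h
  exact ⟨γ, m + n, by rw [Function.iterate_add_apply, hm]⟩

theorem height_parent (hp : IsResolution p c) (w : Z.V) :
    height p c (parent p c w) = height p c w - 1 := by
  have hpw : p (parent p c w) = p w := hp.map_next w
  unfold height
  rw [hpw]
  by_cases hw : w = c (p w)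
  · have : parent p c w = c (p w) := by
      unfold parent
      rw [← hw, Z.next_self]
    rw [this, ← hw, Z.length_geodesic_self]
  · have := Z.length_geodesic_next hw
    unfold parent
    omega

theorem height_iterate (hp : IsResolution p c) (n : ℕ) (w : Z.V) :
    height p c ((parent p c)^[n] w) = height p c w - n := by
  induction n with
  | zero => rfl
  | succ n ih => rw [Function.iterate_succ_apply', height_parent hp, ih, Nat.sub_sub]

theorem parent_smul (hp : IsResolution p c) (γ : G) (w : Z.V) :
    parent p c (Z.smul γ w) = Z.smul γ (parent p c w) := by
  unfold parent
  rw [hp.map_smul, hp.section_smul, Z.next_smul]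

theorem iterate_smul (hp : IsResolution p c) (n : ℕ) (γ : G) (w : Z.V) :
    (parent p c)^[n] (Z.smul γ w) = Z.smul γ ((parent p c)^[n] w) := by
  induction n with
  | zero => rfl
  | succ n ih =>
    rw [Function.iterate_succ_apply', Function.iterate_succ_apply', ih, parent_smul hp]

theorem height_smul (hp : IsResolution p c) (γ : G) (w : Z.V) :
    height p c (Z.smul γ w) = height p c w := by
  unfold height
  rw [hp.map_smul, hp.section_smul, Z.length_geodesic_smul]

theorem map_iterate (hp : IsResolution p c) (n : ℕ) (w : Z.V) :
    p ((parent p c)^[n] w) = p w := by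
  induction n with
  | zero => rfl
  | succ n ih =>
    rw [Function.iterate_succ_apply']
    exact (hp.map_next _).trans ih

theorem stab_le_iterate (hp : IsResolution p c) (n : ℕ) (w : Z.V) :
    Z.stab w ≤ Z.stab ((parent p c)^[n] w) := fun γ hγ => by
  rw [mem_stab, ← iterate_smul hp, Z.mem_stab.1 hγ]

theorem parent_eq_or_parent_eq {u v : Z.V} (h : Z.graph.Adj u v) (huv : p u = p v) :
    parent p c u = v ∨ parent p c v = u := by
  unfold parent
  rw [← huv]
  exact Z.next_eq_or_next_eq _ h

theorem fiberAdj_parent (hp : IsResolution p c) {w : Z.V} (hw : w ≠ c (p w)) :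
    FiberAdj p w (parent p c w) :=
  ⟨Z.adj_next hw, (hp.map_next w).symm⟩

variable (hp : IsResolution p c) (hX : X.StronglySlideFree) (hot : Z.graph.Adj o t)
  (hle : Z.stab o ≤ Z.stab t) (ht : ∀ γ, t ≠ Z.smul γ o) (hne : p o ≠ p t)

include hp in
theorem chain_slide_of_not_isBelow {w : Z.V} (hw : ¬IsBelow p c o w) :
    Relation.ReflTransGen (FiberAdj (p ∘ slide p c o t)) w (c (p w)) := by
  obtain ⟨n, hn⟩ : ∃ n, height p c w = n := ⟨_, rfl⟩
  induction n generalizing w with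
  | zero =>
    have : w = c (p w) := SimpleGraph.Walk.eq_of_length_eq_zero hn
    rw [← this]
  | succ n ih =>
    by_cases hroot : w = c (p w)
    · rw [← hroot]
    have hadj := fiberAdj_parent hp hroot
    have hpar : ¬IsBelow p c o (parent p c w) := fun h => hw (isBelow_of_iterate (n := 1) h)
    have := ih hpar (by rw [height_parent hp, hn]; rfl)
    rw [← hadj.2] at this
    refine .head ⟨hadj.1, ?_⟩ this
    rw [Function.comp_apply, Function.comp_apply, slide_of_not_isBelow hw,
      slide_of_not_isBelow hpar, hadj.2]

include hp hX hle hne in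
theorem height_pos : 0 < height p c o := by
  refine Nat.pos_of_ne_zero fun h => hne ?_
  have ho : o = c (p o) := SimpleGraph.Walk.eq_of_length_eq_zero h
  refine hX.proper.eq_of_stab_le ?_
  refine (hp.stab_le_section _).trans ?_
  rw [← ho]
  exact hle.trans (hp.stab_le_map t)

include hp hX hle hne

theorem iterate_unique {w : Z.V} {γ δ : G} {n m : ℕ} (hn : (parent p c)^[n] w = Z.smul γ o)
    (hm : (parent p c)^[m] w = Z.smul δ o) : n = m := by
  have h1 := height_iterate hp n w
  have h2 := height_iterate hp m w
  rw [hn, height_smul hp] at h1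
  rw [hm, height_smul hp] at h2
  have := height_pos hp hX hle hne
  omega

theorem slide_eq {w : Z.V} {γ : G} {n : ℕ} (h : (parent p c)^[n] w = Z.smul γ o) :
    slide p c o t w = Z.smul γ t := by
  have hw : IsBelow p c o w := ⟨γ, n, h⟩
  rw [slide, dif_pos hw]
  obtain ⟨m, hm⟩ := hw.choose_spec
  obtain rfl := iterate_unique hp hX hle hne hm h
  exact smul_eq_smul_of_stab_le Z hle (hm.symm.trans h)

theorem slide_smul (γ : G) (w : Z.V) :
    slide p c o t (Z.smul γ w) = Z.smul γ (slide p c o t w) := by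
  by_cases hw : IsBelow p c o w
  · obtain ⟨δ, n, hn⟩ := hw
    have : (parent p c)^[n] (Z.smul γ w) = Z.smul (γ * δ) o := by
      rw [iterate_smul hp, hn, Z.smul_mul]
    rw [slide_eq hp hX hle hne hn, slide_eq hp hX hle hne this, Z.smul_mul]
  · rw [slide_of_not_isBelow hw, slide_of_not_isBelow]
    rintro ⟨δ, n, hn⟩
    refine hw ⟨γ⁻¹ * δ, n, ?_⟩
    rw [Z.smul_mul, ← hn, iterate_smul hp, inv_smul_smul]

theorem not_isBelow_section (x : X.V) : ¬IsBelow p c o (c x) := by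
  rintro ⟨γ, n, h⟩
  have h1 := height_iterate hp n (c x)
  have h0 : height p c (c x) = 0 := by
    unfold height
    rw [hp.map_section, Z.length_geodesic_self]
  rw [h, height_smul hp, h0] at h1
  have := height_pos hp hX hle hne
  omega

include hot

/-- The only edges leaving the fiber at a descendant of `γ o` are translates of `(o, t)`. -/
theorem eq_of_adj_of_isBelow {u v : Z.V} {γ : G} {n : ℕ} (huv : Z.graph.Adj u v)
    (hpuv : p u ≠ p v) (hn : (parent p c)^[n] u = Z.smul γ o) :
    u = Z.smul γ o ∧ v = Z.smul γ t := by
  have hot' : Z.graph.Adj (Z.smul γ o) (Z.smul γ t) := Z.smul_adj γ hot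
  have hpo : p (Z.smul γ o) = p u := by rw [← hn, map_iterate hp]
  have hpne : p (Z.smul γ o) ≠ p (Z.smul γ t) := fun h => by
    rw [hp.map_smul, hp.map_smul] at h
    exact hne (X.smul_injective γ h)
  have hadj := (hp.map_adj huv).resolve_left hpuv
  have hadj' := (hp.map_adj hot').resolve_left hpne
  have hstab : X.stab (p u) ⊓ X.stab (p v) ≤ X.stab (p (Z.smul γ o)) ⊓ X.stab (p (Z.smul γ t)) := by
    rintro δ ⟨hu, hv⟩
    refine ⟨by rwa [hpo], ?_⟩
    have h1 := (hp.lift_unique huv (Z.smul_adj δ huv) hpuv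
      (by rw [hp.map_smul, X.mem_stab.1 hu]) (by rw [hp.map_smul, X.mem_stab.1 hv])).1
    have h2 : δ ∈ Z.stab ((parent p c)^[n] u) := stab_le_iterate hp n u h1.symm
    rw [hn, mem_stab, ← Z.smul_mul] at h2
    refine hp.stab_le_map _ ?_
    rw [mem_stab, ← Z.smul_mul]
    exact smul_eq_smul_of_stab_le Z hle h2
  obtain ⟨κ, hκ⟩ := hX.2 ⟨(p u, p v), hadj⟩ ⟨(p (Z.smul γ o), p (Z.smul γ t)), hadj'⟩
    hpo.symm hstab
  have hκu : X.smul κ (p u) = p (Z.smul γ o) := congrArg (fun e => e.1.1) hκ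
  have hκv : X.smul κ (p v) = p (Z.smul γ t) := congrArg (fun e => e.1.2) hκ
  obtain ⟨h1, h2⟩ := hp.lift_unique hot' (Z.smul_adj κ huv) hpne
    (hκu.symm.trans (hp.map_smul κ u).symm) (hκv.symm.trans (hp.map_smul κ v).symm)
  have hu : u = Z.smul (κ⁻¹ * γ) o := by rw [Z.smul_mul, h1, inv_smul_smul]
  have hv : v = Z.smul (κ⁻¹ * γ) t := by rw [Z.smul_mul, h2, inv_smul_smul]
  obtain rfl := iterate_unique (m := 0) hp hX hle hne hn hu
  have huo : u = Z.smul γ o := hn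
  refine ⟨huo, hv.trans ?_⟩
  exact smul_eq_smul_of_stab_le Z hle (hu.symm.trans huo)

/-- Adjacent vertices of a common fiber, the second being the parent of the first, map to equal
or adjacent vertices after sliding. -/
theorem map_slide_parent {u v : Z.V} (huv : parent p c u = v) :
    p (slide p c o t u) = p (slide p c o t v) ∨
      X.graph.Adj (p (slide p c o t u)) (p (slide p c o t v)) := by
  have hpuv : p v = p u := by
    rw [← huv]
    exact hp.map_next u
  by_cases hu : IsBelow p c o u
  · obtain ⟨γ, n, hn⟩ := hu
    cases n with
    | succ n =>
      rw [Function.iterate_succ_apply, huv] at hn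
      left
      rw [slide_eq hp hX hle hne hn, slide_eq (n := n + 1) (w := u) hp hX hle hne (γ := γ)]
      rw [Function.iterate_succ_apply, huv, hn]
    | zero =>
      have huo : u = Z.smul γ o := hn
      have hv : ¬IsBelow p c o v := by
        rintro ⟨δ, m, hm⟩
        rw [← huv, ← Function.iterate_succ_apply] at hm
        exact absurd (iterate_unique hp hX hle hne hn hm) (Nat.succ_ne_zero m).symm
      right
      rw [slide_eq hp hX hle hne hn, slide_of_not_isBelow hv, hpuv, huo, hp.map_smul, hp.map_smul]
      exact X.smul_adj γ ((hp.map_adj hot).resolve_left hne).symm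
  · have hv : ¬IsBelow p c o v := fun hv => hu (isBelow_of_iterate (n := 1) (by
      rwa [Function.iterate_one, huv]))
    rw [slide_of_not_isBelow hu, slide_of_not_isBelow hv]
    exact .inl hpuv.symm

include ht

theorem not_isBelow_smul (δ : G) : ¬IsBelow p c o (Z.smul δ t) := by
  rintro ⟨γ, n, hn⟩
  have hpne : p (Z.smul δ t) ≠ p (Z.smul δ o) := fun h => by
    rw [hp.map_smul, hp.map_smul] at h
    exact hne (X.smul_injective δ h).symm
  have := (eq_of_adj_of_isBelow hp hX hot hle hne (Z.smul_adj δ hot.symm) hpne hn).1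
  exact ht (δ⁻¹ * γ) (by rw [Z.smul_mul, ← this, inv_smul_smul])

theorem map_slide_of_ne {u v : Z.V} (huv : Z.graph.Adj u v) (hpuv : p u ≠ p v)
    (hu : IsBelow p c o u) : p (slide p c o t u) = p (slide p c o t v) := by
  obtain ⟨γ, n, hn⟩ := hu
  obtain ⟨-, rfl⟩ := eq_of_adj_of_isBelow hp hX hot hle hne huv hpuv hn
  rw [slide_eq hp hX hle hne hn,
    slide_of_not_isBelow (not_isBelow_smul hp hX hot hle ht hne γ)]

theorem chain_slide_of_iterate {w : Z.V} {γ : G} {n : ℕ}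
    (hn : (parent p c)^[n] w = Z.smul γ o) :
    Relation.ReflTransGen (FiberAdj (p ∘ slide p c o t)) w (c (p (Z.smul γ t))) := by
  induction n generalizing w with
  | zero =>
    obtain rfl : w = Z.smul γ o := hn
    have hγ := not_isBelow_smul hp hX hot hle ht hne γ
    refine .head ⟨Z.smul_adj γ hot, ?_⟩ (chain_slide_of_not_isBelow hp hγ)
    rw [Function.comp_apply, Function.comp_apply, slide_of_not_isBelow hγ,
      slide_eq (n := 0) hp hX hle hne rfl]
  | succ n ih =>
    have hroot : w ≠ c (p w) := fun h =>
      not_isBelow_section hp hX hle hne (p w) (h ▸ ⟨γ, n + 1, hn⟩)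
    have hpar : (parent p c)^[n] (parent p c w) = Z.smul γ o := hn
    refine .head ⟨(fiberAdj_parent hp hroot).1, ?_⟩ (ih hpar)
    rw [Function.comp_apply, Function.comp_apply, slide_eq hp hX hle hne hn,
      slide_eq hp hX hle hne hpar]

/-- Sliding the branch at `o` across the edge `(o, t)` gives another resolution. -/
theorem isResolution_slide : IsResolution (p ∘ slide p c o t) c where
  map_smul γ w := by
    rw [Function.comp_apply, slide_smul hp hX hle hne, hp.map_smul]
    rfl
  section_smul := hp.section_smul
  map_section x := by
    rw [Function.comp_apply, slide_of_not_isBelow (not_isBelow_section hp hX hle hne x),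
      hp.map_section]
  map_adj {u v} huv := by
    by_cases hpuv : p u = p v
    · rcases parent_eq_or_parent_eq (c := c) huv hpuv with h | h
      · exact map_slide_parent hp hX hot hle hne h
      · exact (map_slide_parent hp hX hot hle hne h).imp Eq.symm SimpleGraph.Adj.symm
    · by_cases hu : IsBelow p c o u
      · exact .inl (map_slide_of_ne hp hX hot hle ht hne huv hpuv hu)
      by_cases hv : IsBelow p c o v
      · exact .inl (map_slide_of_ne hp hX hot hle ht hne huv.symm (Ne.symm hpuv) hv).symm
      rw [Function.comp_apply, Function.comp_apply, slide_of_not_isBelow hu,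
        slide_of_not_isBelow hv]
      exact hp.map_adj huv
  chain w := by
    by_cases hw : IsBelow p c o w
    · obtain ⟨γ, n, hn⟩ := hw
      rw [Function.comp_apply, slide_eq hp hX hle hne hn]
      exact chain_slide_of_iterate hp hX hot hle ht hne hn
    · rw [Function.comp_apply, slide_of_not_isBelow hw]
      exact chain_slide_of_not_isBelow hp hw

theorem map_slide_eq : p (slide p c o t o) = p (slide p c o t t) := by
  have h1 : (parent p c)^[0] o = Z.smul 1 o := (Z.smul_one o).symm
  have h2 := not_isBelow_smul hp hX hot hle ht hne 1
  rw [Z.smul_one] at h2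
  rw [slide_eq hp hX hle hne h1, slide_of_not_isBelow h2, Z.smul_one]

end Slide

section Deformation

variable {X : GTree G}

theorem Collapse.resolves_iff (hX : X.StronglySlideFree) {Z Z' : GTree G} (h : Collapse Z Z') :
    Resolves Z X ↔ Resolves Z' X := by
  obtain ⟨φ, e, h⟩ := h
  have hσ := Function.rightInverse_surjInv h.surjective
  refine ⟨?_, fun ⟨p, c, hp⟩ => ⟨_, _, h.isResolution_comp hp hσ⟩⟩
  rintro ⟨p, c, hp⟩
  by_cases he : p (d0 e) = p (d1 e)
  · exact ⟨_, _, h.isResolution_desc hp hσ he⟩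
  · exact ⟨_, _, h.isResolution_desc
      (isResolution_slide hp hX e.2 h.stab_le h.d1_ne he) hσ
      (map_slide_eq hp hX e.2 h.stab_le h.d1_ne he)⟩

theorem ElemDeformation.resolves_iff (hX : X.StronglySlideFree) {Z Z' : GTree G}
    (h : ElemDeformation Z Z') : Resolves Z X ↔ Resolves Z' X := by
  induction h with
  | rel _ _ h => exact Collapse.resolves_iff hX h
  | refl => rfl
  | symm _ _ _ ih => exact ih.symm
  | trans _ _ _ _ _ ih₁ ih₂ => exact ih₁.trans ih₂

end Deformation

end GTree

open GTree in
/-- Theorem B: let `X` and `Y` be cocompact `G`-trees that are related by an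
elementary deformation.  If `X` is strongly slide-free and `Y` is reduced,
then there is a unique isomorphism of `G`-trees `X → Y`. -/
theorem unique_iso_of_elemDeformation {G : Type u} [Group G] (X Y : GTree G)
    (hXc : X.Cocompact) (hYc : Y.Cocompact)
    (hdef : ElemDeformation X Y)
    (hssf : X.StronglySlideFree) (hred : Y.Reduced) :
    ∃! φ : X.V → Y.V, IsGIso X Y φ := by
  obtain ⟨p, c, hp⟩ := (ElemDeformation.resolves_iff hssf hdef).1 (Resolves.refl X)
  exact ⟨c, hp.isGIso_section hred, fun _ hφ =>
    hssf.proper.unique_isGIso hφ (hp.isGIso_section hred)⟩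
end

section
/- Let X and Y be proper G-trees which define the same partition of G into elliptic and hyperbolic elements. Suppose in addition that X is locally finite. Then every vertex stabilizer of X fixes a vertex of Y. -/
universe u

namespace SimpleGraph

variable {V : Type*} {T : SimpleGraph V}

theorem Connected.exists_adj_dist_eq_succ (hT : T.Connected) {y z : V} (h : y ≠ z) :
    ∃ a, T.Adj y a ∧ T.dist y z = T.dist a z + 1 := by
  obtain ⟨p, hp⟩ := hT.exists_walk_length_eq_dist y z
  cases p with
  | nil => exact absurd rfl h
  | @cons _ a _ hya p =>
    refine ⟨a, hya, ?_⟩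
    have h₁ := dist_le p
    have h₂ := hT.dist_triangle (u := y) (v := a) (w := z)
    rw [dist_eq_one_iff_adj.2 hya] at h₂
    rw [Walk.length_cons] at hp
    omega

/-- A point of a geodesic of a tree is determined by its distance to one end. -/
theorem IsTree.eq_of_dist_add_dist (hT : T.IsTree) {z w y y' : V}
    (h : T.dist z y + T.dist y w = T.dist z w) (h' : T.dist z y' + T.dist y' w = T.dist z w)
    (hd : T.dist z y = T.dist z y') : y = y' := by
  have key : ∀ x, T.dist z x + T.dist x w = T.dist z w →
      ∃ p : T.Path z w, p.1.getVert (T.dist z x) = x := by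
    intro x hx
    obtain ⟨p, hp⟩ := hT.connected.exists_walk_length_eq_dist z x
    obtain ⟨q, hq⟩ := hT.connected.exists_walk_length_eq_dist x w
    refine ⟨⟨p.append q, (p.append q).isPath_of_length_eq_dist ?_⟩, ?_⟩
    · rw [Walk.length_append]; omega
    · simp [Walk.getVert_append, hp]
  obtain ⟨p, hp⟩ := key y h
  obtain ⟨q, hq⟩ := key y' h'
  rw [← hp, ← hq, hd, (hT.isAcyclic.subsingleton_path z w).elim p q]

theorem IsTree.eq_of_adj_of_dist_eq_succ (hT : T.IsTree) {y z a b : V} (hya : T.Adj y a)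
    (ha : T.dist y z = T.dist a z + 1) (hyb : T.Adj y b) (hb : T.dist y z = T.dist b z + 1) :
    a = b := by
  have h₁ := dist_eq_one_iff_adj.2 hya
  have h₂ := dist_eq_one_iff_adj.2 hyb
  exact hT.eq_of_dist_add_dist (w := z) (by omega) (by omega) (h₁.trans h₂.symm)

theorem IsTree.dist_eq_add_of_dist_eq_succ (hT : T.IsTree) {z w y b : V} (hyb : T.Adj y b)
    (hb : T.dist z b = T.dist z y + 1) (hw : T.dist y w = T.dist b w + 1) :
    T.dist z w = T.dist z y + T.dist y w := by
  induction hn : T.dist b w generalizing y b with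
  | zero =>
    obtain rfl := hT.connected.dist_eq_zero_iff.1 hn
    omega
  | succ n ih =>
    have hbw : b ≠ w := by rintro rfl; simp at hn
    obtain ⟨c, hbc, hc⟩ := hT.connected.exists_adj_dist_eq_succ hbw
    have hzc : T.dist z c = T.dist z b + 1 := by
      refine (hT.dist_eq_dist_add_one_of_adj z hbc).resolve_left fun h => ?_
      have hcy : c = y := hT.eq_of_adj_of_dist_eq_succ (z := z) hbc
        (by rwa [T.dist_comm (u := b), T.dist_comm (u := c)]) hyb.symm
        (by rwa [T.dist_comm (u := b), T.dist_comm (u := y)])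
      subst hcy
      omega
    have := ih hbc hzc hc (by omega)
    omega

/-- If the geodesics from `y` to `z` and to `w` start with different edges, then `y` lies on
the geodesic from `z` to `w`. -/
theorem IsTree.dist_eq_add_of_ne (hT : T.IsTree) {y z w a b : V} (hya : T.Adj y a)
    (ha : T.dist y z = T.dist a z + 1) (hyb : T.Adj y b) (hb : T.dist y w = T.dist b w + 1)
    (hab : a ≠ b) : T.dist z w = T.dist z y + T.dist y w := by
  refine hT.dist_eq_add_of_dist_eq_succ hyb ?_ hb
  refine (hT.dist_eq_dist_add_one_of_adj z hyb).resolve_left fun h => hab ?_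
  exact hT.eq_of_adj_of_dist_eq_succ hya ha hyb
    (by rwa [T.dist_comm (u := y), T.dist_comm (u := b)])

end SimpleGraph

namespace GTree

variable {G : Type u} [Group G] (Y : GTree G)

theorem smul_inv_smul_s12 (g : G) (x : Y.V) : Y.smul g (Y.smul g⁻¹ x) = x := by
  rw [← Y.smul_mul, mul_inv_cancel, Y.smul_one]

theorem inv_smul_smul_s12 (g : G) (x : Y.V) : Y.smul g⁻¹ (Y.smul g x) = x := by
  rw [← Y.smul_mul, inv_mul_cancel, Y.smul_one]

theorem smul_injective_s12 (g : G) : Function.Injective (Y.smul g) :=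
  Function.LeftInverse.injective (Y.inv_smul_smul_s12 g)

theorem dist_smul_le (g : G) (x y : Y.V) :
    Y.graph.dist (Y.smul g x) (Y.smul g y) ≤ Y.graph.dist x y := by
  obtain ⟨p, hp⟩ := Y.isTree.connected.exists_walk_length_eq_dist x y
  let f : Y.graph →g Y.graph := ⟨Y.smul g, fun h => Y.smul_adj g h⟩
  rw [← hp, ← p.length_map f]
  exact SimpleGraph.dist_le _

theorem dist_smul (g : G) (x y : Y.V) :
    Y.graph.dist (Y.smul g x) (Y.smul g y) = Y.graph.dist x y := by
  refine le_antisymm (Y.dist_smul_le g x y) ?_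
  simpa only [inv_smul_smul_s12] using Y.dist_smul_le g⁻¹ (Y.smul g x) (Y.smul g y)

theorem exists_fixed_on_geodesic {h : G} (hh : Y.Elliptic h) (v : Y.V) :
    ∃ w, Y.smul h w = w ∧
      Y.graph.dist v w + Y.graph.dist w (Y.smul h v) = Y.graph.dist v (Y.smul h v) := by
  obtain ⟨w, hw, hmin⟩ := exists_minimalFor_of_wellFoundedLT
    (fun w => Y.smul h w = w) (fun w => Y.graph.dist w v) hh
  refine ⟨w, hw, ?_⟩
  rcases eq_or_ne w v with rfl | hwv
  · simp
  obtain ⟨a, hwa, ha⟩ := Y.isTree.connected.exists_adj_dist_eq_succ hwv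
  refine (Y.isTree.dist_eq_add_of_ne hwa ha (b := Y.smul h a) ?_ ?_ ?_).symm
  · simpa only [hw] using Y.smul_adj h hwa
  · rw [Y.dist_smul, ← ha]
    simpa only [hw] using Y.dist_smul h w v
  · intro hfix
    have h₁ := hmin (j := a) hfix.symm (show Y.graph.dist a v ≤ Y.graph.dist w v by omega)
    have h₂ : Y.graph.dist w v ≤ Y.graph.dist a v := h₁
    omega

/-- **Serre's lemma**: two elliptic elements with elliptic product have a common fixed vertex. -/
theorem exists_common_fixed {h k : G} (hh : Y.Elliptic h) (hk : Y.Elliptic k)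
    (hhk : Y.Elliptic (h * k)) : ∃ w, Y.smul h w = w ∧ Y.smul k w = w := by
  obtain ⟨v, hv⟩ := hhk
  rw [Y.smul_mul] at hv
  obtain ⟨w, hw, hwd⟩ := Y.exists_fixed_on_geodesic hk v
  obtain ⟨w', hw', hwd'⟩ := Y.exists_fixed_on_geodesic hh (Y.smul k v)
  rw [hv] at hwd'
  have h₁ := Y.dist_smul k w v
  have h₂ := Y.dist_smul h w' (Y.smul k v)
  rw [hw] at h₁
  rw [hw', hv] at h₂
  have c := Y.graph.dist_comm (u := v) (v := w)
  have c₁ := Y.graph.dist_comm (u := v) (v := w')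
  have c₂ := Y.graph.dist_comm (u := w') (v := Y.smul k v)
  have c₃ := Y.graph.dist_comm (u := v) (v := Y.smul k v)
  obtain rfl : w = w' := Y.isTree.eq_of_dist_add_dist hwd (by omega) (by omega)
  exact ⟨w, hw', hw⟩

/-- `a` is the neighbour of `y` in the direction of the fixed subtree of `h`, which does not
contain `y`. -/
def TowardFixed (h : G) (y a : Y.V) : Prop :=
  Y.smul h y ≠ y ∧ Y.graph.Adj y a ∧
    ∃ z, Y.smul h z = z ∧ Y.graph.dist y z = Y.graph.dist a z + 1

variable {Y}

theorem exists_towardFixed {h : G} {y z : Y.V} (hz : Y.smul h z = z) (hy : Y.smul h y ≠ y) :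
    ∃ a, Y.TowardFixed h y a ∧ Y.graph.dist y z = Y.graph.dist a z + 1 := by
  obtain ⟨a, hya, ha⟩ := Y.isTree.connected.exists_adj_dist_eq_succ
    (show y ≠ z by rintro rfl; exact hy hz)
  exact ⟨a, ⟨hy, hya, z, hz, ha⟩, ha⟩

theorem TowardFixed.dist_eq {h : G} {y a w : Y.V} (H : Y.TowardFixed h y a)
    (hw : Y.smul h w = w) : Y.graph.dist y w = Y.graph.dist a w + 1 := by
  obtain ⟨hy, hya, z, hz, ha⟩ := H
  obtain ⟨b, ⟨-, hyb, -⟩, hb⟩ := exists_towardFixed hw hy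
  by_contra hne
  have hab : a ≠ b := by rintro rfl; exact hne hb
  have hadd := Y.isTree.dist_eq_add_of_ne hya ha hyb hb hab
  have h₁ := Y.dist_smul h z y
  have h₂ := Y.dist_smul h y w
  rw [hz] at h₁
  rw [hw] at h₂
  exact hy (Y.isTree.eq_of_dist_add_dist (by omega) hadd.symm h₁)

theorem TowardFixed.eq {h k : G} {y a b w : Y.V} (H : Y.TowardFixed h y a)
    (K : Y.TowardFixed k y b) (hw : Y.smul h w = w) (kw : Y.smul k w = w) : a = b :=
  Y.isTree.eq_of_adj_of_dist_eq_succ H.2.1 (H.dist_eq hw) K.2.1 (K.dist_eq kw)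

theorem TowardFixed.smul {h : G} {y a : Y.V} (H : Y.TowardFixed h y a) (g : G) :
    Y.TowardFixed (g * h * g⁻¹) (Y.smul g y) (Y.smul g a) := by
  obtain ⟨hy, hya, z, hz, ha⟩ := H
  refine ⟨?_, Y.smul_adj g hya, Y.smul g z, ?_, ?_⟩
  · rw [Y.smul_mul, Y.smul_mul, Y.inv_smul_smul_s12]
    exact fun e => hy (Y.smul_injective_s12 g e)
  · rw [Y.smul_mul, Y.smul_mul, Y.inv_smul_smul_s12, hz]
  · rw [Y.dist_smul, Y.dist_smul, ha]

theorem exists_towardFixed_of_not_fixesVertex {H : Subgroup G} (hell : ∀ h ∈ H, Y.Elliptic h)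
    (hfix : ¬ Y.FixesVertex H) (y : Y.V) : ∃ a, ∃ h ∈ H, Y.TowardFixed h y a := by
  simp only [FixesVertex, not_exists, not_forall] at hfix
  obtain ⟨h, hh, hy⟩ := hfix y
  obtain ⟨z, hz⟩ := hell h hh
  obtain ⟨a, ha, -⟩ := exists_towardFixed hz hy
  exact ⟨a, h, hh, ha⟩

theorem TowardFixed.eq_of_mem {H : Subgroup G} (hell : ∀ h ∈ H, Y.Elliptic h) {h k : G}
    (hh : h ∈ H) (hk : k ∈ H) {y a b : Y.V} (ha : Y.TowardFixed h y a)
    (hb : Y.TowardFixed k y b) : a = b := by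
  obtain ⟨w, hw, kw⟩ :=
    Y.exists_common_fixed (hell h hh) (hell k hk) (hell _ (H.mul_mem hh hk))
  exact ha.eq hb hw kw

/-- A group of elliptic elements fixes a vertex as soon as a subgroup with finitely many cosets
does. -/
theorem FixesVertex.of_finite_cosets {H K : Subgroup G} (hell : ∀ h ∈ H, Y.Elliptic h)
    (hKH : K ≤ H) {F : Set G} (hF : F.Finite) (hFH : F ⊆ H)
    (hcov : ∀ h ∈ H, ∃ f ∈ F, f⁻¹ * h ∈ K) (hK : Y.FixesVertex K) : Y.FixesVertex H := by
  by_contra hfix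
  obtain ⟨y, hy⟩ := hK
  choose n t htH ht using exists_towardFixed_of_not_fixesVertex hell hfix
  have hn {h : G} (hh : h ∈ H) {x : Y.V} (hx : Y.smul h x = x) : Y.smul h (n x) = n x := by
    have := (ht x).smul h
    rw [hx] at this
    exact this.eq_of_mem hell (H.mul_mem (H.mul_mem hh (htH x)) (H.inv_mem hh)) (htH x) (ht x)
  have hiter {h : G} (hh : h ∈ H) {x : Y.V} (hx : Y.smul h x = x) (N : ℕ) :
      Y.smul h (n^[N] x) = n^[N] x := by
    induction N with
    | zero => exact hx
    | succ N ih => rw [Function.iterate_succ_apply']; exact hn hh ih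
  have hreach {h : G} (hh : h ∈ H) {z : Y.V} (hz : Y.smul h z = z) (d : ℕ) :
      ∀ x, Y.graph.dist x z = d → ∃ N, Y.smul h (n^[N] x) = n^[N] x := by
    induction d with
    | zero =>
      intro x hx
      obtain rfl := Y.isTree.connected.dist_eq_zero_iff.1 hx
      exact ⟨0, hz⟩
    | succ d ih =>
      intro x hx
      by_cases hxf : Y.smul h x = x
      · exact ⟨0, hxf⟩
      obtain ⟨a, ha, had⟩ := exists_towardFixed hz hxf
      obtain rfl := ha.eq_of_mem hell hh (htH x) (ht x)
      obtain ⟨N, hN⟩ := ih (n x) (by omega)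
      exact ⟨N + 1, by rwa [Function.iterate_succ_apply]⟩
  have hev : ∀ᶠ N in Filter.atTop, ∀ f ∈ F, Y.smul f (n^[N] y) = n^[N] y := by
    refine (Filter.eventually_all_finite hF).2 fun f hf => ?_
    obtain ⟨z, hz⟩ := hell f (hFH hf)
    obtain ⟨N, hN⟩ := hreach (hFH hf) hz _ y rfl
    filter_upwards [Filter.eventually_ge_atTop N] with M hM
    obtain ⟨j, rfl⟩ := Nat.exists_eq_add_of_le' hM
    rw [Function.iterate_add_apply]
    exact hiter (hFH hf) hN j
  obtain ⟨N, hN⟩ := hev.exists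
  refine hfix ⟨n^[N] y, fun h hh => ?_⟩
  obtain ⟨f, hf, hfK⟩ := hcov h hh
  have hK' := hiter (hKH hfK) (hy _ hfK) N
  rw [← mul_inv_cancel_left f h, Y.smul_mul, hK', hN f hf]

theorem LocallyFinite.fixesVertex_stab {X : GTree G} (hlf : X.LocallyFinite) {x x' : X.V}
    (hadj : X.graph.Adj x x') (hell : ∀ h ∈ X.stab x, Y.Elliptic h)
    (hfix : Y.FixesVertex (X.stab x ⊓ X.stab x')) : Y.FixesVertex (X.stab x) := by
  have hfin : ((fun g => X.smul g x') '' (X.stab x : Set G)).Finite := by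
    refine (hlf x).subset ?_
    rintro _ ⟨g, hg, rfl⟩
    have := X.smul_adj g hadj
    rwa [show X.smul g x = x from hg] at this
  choose! r hr hrx' using fun s (hs : s ∈ (fun g => X.smul g x') '' (X.stab x : Set G)) => hs
  refine hfix.of_finite_cosets hell inf_le_left (hfin.image r) ?_ fun h hh => ?_
  · rintro _ ⟨s, hs, rfl⟩
    exact hr s hs
  · have hs := Set.mem_image_of_mem (fun g => X.smul g x') hh
    refine ⟨_, Set.mem_image_of_mem r hs,
      (X.stab x).mul_mem ((X.stab x).inv_mem (hr _ hs)) hh, ?_⟩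
    change X.smul _ x' = x'
    have hr' : X.smul (r (X.smul h x')) x' = X.smul h x' := hrx' _ hs
    rw [X.smul_mul]
    exact (congrArg _ hr'.symm).trans (X.inv_smul_smul_s12 _ x')

/-- If every `X`-elliptic element is `Y`-elliptic, with `X` locally finite and `Y` proper, then
the vertex stabilizers of `X` fix vertices of `Y`. -/
theorem Proper.fixesVertex_stab {X : GTree G} (hY : Y.Proper) (hlf : X.LocallyFinite)
    (hell : ∀ γ : G, X.Elliptic γ → Y.Elliptic γ) (x : X.V) : Y.FixesVertex (X.stab x) := by
  by_contra hx
  have hell' (v : X.V) : ∀ h ∈ X.stab v, Y.Elliptic h := fun h hh => hell h ⟨v, hh⟩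
  have hstep {v v' : X.V} (hadj : X.graph.Adj v v') (hv : ¬ Y.FixesVertex (X.stab v)) :
      ¬ Y.FixesVertex (X.stab v') ∧ ∀ y a, (∃ h ∈ X.stab v, Y.TowardFixed h y a) →
        ∃ h ∈ X.stab v', Y.TowardFixed h y a := by
    have hinf : ¬ Y.FixesVertex (X.stab v ⊓ X.stab v') := fun h =>
      hv (hlf.fixesVertex_stab hadj (hell' v) h)
    refine ⟨fun ⟨w, hw⟩ => hinf ⟨w, fun h hh => hw h hh.2⟩, ?_⟩
    rintro y a ⟨h, hh, ha⟩
    obtain ⟨b, k, hk, hb⟩ := exists_towardFixed_of_not_fixesVertex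
      (fun k hk => hell' v k (Subgroup.mem_inf.1 hk).1) hinf y
    obtain rfl := ha.eq_of_mem (hell' v) hh hk.1 hb
    exact ⟨k, hk.2, hb⟩
  have hall {v v' : X.V} (p : X.graph.Walk v v') (hv : ¬ Y.FixesVertex (X.stab v)) :
      ∀ y a, (∃ h ∈ X.stab v, Y.TowardFixed h y a) → ∃ h ∈ X.stab v', Y.TowardFixed h y a := by
    induction p with
    | nil => exact fun _ _ h => h
    | cons hadj p ih => exact fun y a h => ih (hstep hadj hv).1 y a ((hstep hadj hv).2 y a h)
  obtain ⟨y⟩ := Y.isTree.connected.nonempty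
  obtain ⟨a, h, hh, ha⟩ := exists_towardFixed_of_not_fixesVertex (hell' x) hx y
  refine (hY ⟨(y, a), ha.2.1⟩).not_ge fun g hg => ⟨hg, ?_⟩
  have hgy : Y.smul g y = y := hg
  obtain ⟨p⟩ := X.isTree.connected.preconnected x (X.smul g x)
  obtain ⟨k, hk, hka⟩ := hall p hx y a ⟨h, hh, ha⟩
  have hga := ha.smul g
  rw [hgy] at hga
  refine hga.eq_of_mem (hell' (X.smul g x)) ?_ hk hka
  change X.smul (g * h * g⁻¹) (X.smul g x) = X.smul g x
  rw [X.smul_mul, X.smul_mul, X.inv_smul_smul_s12, show X.smul h x = x from hh]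

end GTree

open GTree in
/-- Proposition 6.2: let `X` and `Y` be proper `G`-trees which define the same
partition of `G` into elliptic and hyperbolic elements.  Suppose in addition
that `X` is locally finite.  Then every vertex stabilizer of `X` fixes a
vertex of `Y`. -/
theorem proper_stabilizers_fix_vertex {G : Type u} [Group G] (X Y : GTree G)
    (hX : X.Proper) (hY : Y.Proper)
    (hpart : ∀ γ : G, X.Elliptic γ ↔ Y.Elliptic γ)
    (hlf : X.LocallyFinite) :
    ∀ x : X.V, ∃ y : Y.V, ∀ γ : G, X.smul γ x = x → Y.smul γ y = y := by
  exact hY.fixesVertex_stab hlf (fun γ => (hpart γ).1)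
end
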